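/- Let p be a prime and α ≥ 1 with p^α ≠ 3. Then the number of elements x of the ring ℤ/p^αℤ satisfying x² − x + 1 = 0 (equivalently, x is invertible and x = 1 − x⁻¹) is exactly 2 if p ≡ 1 (mod 6), and 0 otherwise. Moreover, every such solution x satisfies x ≢ 2 (mod p). -/

import Mathlib

theorem ZMod.isUnit_of_castHom_ne_zero {p α : ℕ} (hp : p.Prime) (hα : α ≠ 0)
    {x : ZMod (p ^ α)} (hx : ZMod.castHom (dvd_pow_self p hα) (ZMod p) x ≠ 0) : IsUnit x := by
  have : NeZero (p ^ α) := ⟨pow_ne_zero _ hp.ne_zero⟩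
  obtain ⟨n, rfl⟩ := ZMod.natCast_zmod_surjective x
  rw [map_natCast, Ne, ZMod.natCast_eq_zero_iff] at hx
  rw [ZMod.isUnit_iff_coprime]
  exact (((Nat.Prime.coprime_iff_not_dvd hp).2 hx).symm).pow_right α

theorem ZMod.isUnit_or_isUnit_of_isUnit_sub {p α : ℕ} (hp : p.Prime) (hα : α ≠ 0)
    {a b : ZMod (p ^ α)} (h : IsUnit (a - b)) : IsUnit a ∨ IsUnit b := by
  have : Fact p.Prime := ⟨hp⟩
  by_cases ha : ZMod.castHom (dvd_pow_self p hα) (ZMod p) a = 0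
  · refine .inr (isUnit_of_castHom_ne_zero hp hα fun hb => ?_)
    refine (h.map (ZMod.castHom (dvd_pow_self p hα) (ZMod p))).ne_zero ?_
    rw [map_sub, ha, hb, sub_zero]
  · exact .inl (isUnit_of_castHom_ne_zero hp hα ha)

theorem ZMod.prime_mod_six_eq_one_of_root {p : ℕ} (hp : p.Prime) (h3 : p ≠ 3) {x : ZMod p}
    (hx : x ^ 2 - x + 1 = 0) : p % 6 = 1 := by
  have : Fact p.Prime := ⟨hp⟩
  have hord : orderOf (-x) = 3 := by
    refine orderOf_eq_prime (by linear_combination -(x + 1) * hx) fun h => h3 ?_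
    have h0 : ((3 : ℕ) : ZMod p) = 0 := by
      push_cast
      linear_combination hx + (x - 2) * h
    exact (Nat.prime_dvd_prime_iff_eq hp Nat.prime_three).1 ((ZMod.natCast_eq_zero_iff _ _).1 h0)
  have hx0 : -x ≠ 0 := by
    intro h
    rw [neg_eq_zero] at h
    simp [h] at hx
  have hdvd := hord ▸ ZMod.orderOf_dvd_card_sub_one hx0
  have h1 := hp.one_lt
  rcases hp.eq_two_or_odd with rfl | hodd <;> omega

theorem ZMod.prime_mod_six_eq_one_of_root_pow {p α : ℕ} (hp : p.Prime) (hα : α ≠ 0)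
    (h3 : p ^ α ≠ 3) {x : ZMod (p ^ α)} (hx : x ^ 2 - x + 1 = 0) : p % 6 = 1 := by
  rcases eq_or_ne p 3 with rfl | hp3
  · have h9 : 3 ^ 2 ∣ 3 ^ α := pow_dvd_pow 3 (by
      rcases α with _ | _ | _ <;> simp_all)
    have := congrArg (ZMod.castHom h9 (ZMod (3 ^ 2))) hx
    simp only [map_add, map_sub, map_pow, map_one, map_zero] at this
    generalize ZMod.castHom h9 (ZMod (3 ^ 2)) x = y at this
    revert y
    decide
  · have := congrArg (ZMod.castHom (dvd_pow_self p hα) (ZMod p)) hx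
    simp only [map_add, map_sub, map_pow, map_one, map_zero] at this
    exact prime_mod_six_eq_one_of_root hp hp3 this

theorem ZMod.exists_root_of_prime_mod_six_eq_one {p α : ℕ} (hp : p.Prime) (hα : α ≠ 0)
    (h6 : p % 6 = 1) : ∃ x : ZMod (p ^ α), x ^ 2 - x + 1 = 0 := by
  have : Fact p.Prime := ⟨hp⟩
  have : NeZero (p ^ α) := ⟨pow_ne_zero _ hp.ne_zero⟩
  have hcard : 3 ∣ Fintype.card (ZMod (p ^ α))ˣ := by
    rw [ZMod.card_units_eq_totient, Nat.totient_prime_pow hp (Nat.pos_of_ne_zero hα)]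
    exact Dvd.dvd.mul_left (by omega) _
  obtain ⟨u, hu⟩ := exists_prime_orderOf_dvd_card 3 hcard
  have hu' : orderOf (u : ZMod (p ^ α)) = 3 := by rw [orderOf_units, hu]
  have hcop : (orderOf (u : ZMod (p ^ α))).Coprime (p ^ α) := by
    rw [hu']
    exact ((Nat.coprime_primes Nat.prime_three hp).2 (by omega)).pow_right α
  have hpow : (u : ZMod (p ^ α)) ^ 3 = 1 := hu' ▸ pow_orderOf_eq_one _
  rcases ZMod.eq_one_or_isUnit_sub_one rfl (u : ZMod (p ^ α)) hcop with h | h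
  · simp [h] at hu'
  · exact ⟨-u, h.mul_left_cancel (by linear_combination hpow)⟩

theorem ZMod.ncard_roots_of_prime_mod_six_eq_one {p α : ℕ} (hp : p.Prime) (hα : α ≠ 0)
    (h6 : p % 6 = 1) : Set.ncard {x : ZMod (p ^ α) | x ^ 2 - x + 1 = 0} = 2 := by
  obtain ⟨s, hs⟩ := exists_root_of_prime_mod_six_eq_one hp hα h6
  have : Fact (1 < p ^ α) := ⟨Nat.one_lt_pow hα hp.one_lt⟩
  have hthree : IsUnit (3 : ZMod (p ^ α)) := by
    have := (ZMod.isUnit_iff_coprime 3 (p ^ α)).2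
      (((Nat.coprime_primes Nat.prime_three hp).2 (by omega)).pow_right α)
    exact_mod_cast this
  have hdiff : IsUnit (s - (1 - s)) := by
    have : IsUnit ((s - (1 - s)) ^ 2) := by
      rw [show (s - (1 - s)) ^ 2 = -3 by linear_combination 4 * hs]
      exact hthree.neg
    exact (isUnit_pow_iff two_ne_zero).1 this
  have hroots : {x : ZMod (p ^ α) | x ^ 2 - x + 1 = 0} = {s, 1 - s} := by
    ext x
    simp only [Set.mem_ofPred_eq, Set.mem_insert_iff, Set.mem_singleton_iff]
    constructor
    · intro hx
      have hmul : (x - (1 - s)) * (x - s) = 0 := by linear_combination hx - hs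
      rcases isUnit_or_isUnit_of_isUnit_sub hp hα (a := x - (1 - s)) (b := x - s)
        (by simpa using hdiff) with h | h
      · exact .inl (sub_eq_zero.1 (h.mul_right_eq_zero.1 hmul))
      · exact .inr (sub_eq_zero.1 (h.mul_left_eq_zero.1 hmul))
    · rintro (rfl | rfl)
      · exact hs
      · linear_combination hs
  rw [hroots, Set.ncard_pair (sub_ne_zero.1 hdiff.ne_zero)]

theorem stmt9 (p α : ℕ) (hp : p.Prime) (hα : 1 ≤ α) (h3 : p ^ α ≠ 3) :
    (Set.ncard {x : ZMod (p ^ α) | x ^ 2 - x + 1 = 0} =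
      if p % 6 = 1 then 2 else 0) ∧
    ∀ x : ZMod (p ^ α), x ^ 2 - x + 1 = 0 →
      ZMod.castHom (dvd_pow_self p (by omega : α ≠ 0)) (ZMod p) x ≠ 2 := by
  have hα0 : α ≠ 0 := by omega
  refine ⟨?_, fun x hx h => ?_⟩
  · split_ifs with h6
    · exact ZMod.ncard_roots_of_prime_mod_six_eq_one hp hα0 h6
    · have hempty : {x : ZMod (p ^ α) | x ^ 2 - x + 1 = 0} = ∅ :=
        Set.eq_empty_of_forall_notMem fun x hx =>
          h6 (ZMod.prime_mod_six_eq_one_of_root_pow hp hα0 h3 hx)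
      rw [hempty, Set.ncard_empty]
  · have h6 := ZMod.prime_mod_six_eq_one_of_root_pow hp hα0 h3 hx
    have hx' := congrArg (ZMod.castHom (dvd_pow_self p hα0) (ZMod p)) hx
    simp only [map_add, map_sub, map_pow, map_one, map_zero, h] at hx'
    have h0 : ((3 : ℕ) : ZMod p) = 0 := by
      push_cast
      linear_combination hx'
    have := (Nat.prime_dvd_prime_iff_eq hp Nat.prime_three).1 ((ZMod.natCast_eq_zero_iff _ _).1 h0)
    omega
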